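/- arXiv:2506.13349 — 3 statements merged into one kernel-verified Lean document; each statement's English description precedes it below -/
import Mathlib

section
/- Let C be a Barr-exact protomodular category with a fixed class 𝒵 of zero objects, and let (𝒯, 𝓕) be a 𝒵-torsion theory in C satisfying Conditions (S), (M'), and (P). Let F : C ⟶ 𝓕 be the associated reflector with unit η. Then for a regular epimorphism f : A ⟶ B the following conditions are equivalent: (a) f is a normal extension, i.e., the two kernel-pair projections π₁, π₂ : Eq(f) ⟶ A are trivial extensions; (b) f is a central extension, i.e., there exists a regular epimorphism g such that the pullback g*(f) of f along g is a trivial extension; (c) K[f] belongs to 𝓕. -/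
open CategoryTheory CategoryTheory.Limits

universe v u

/-- A class of zero objects in a category `C`: a collection of objects, closed under
isomorphism, such that every object has a zero part (a monomorphism from a zero object),
there is at most one morphism out of each zero object, and every morphism from a zero
object factors uniquely through any monic zero subobject of its codomain. -/
structure ZeroClass (C : Type u) [Category.{v} C] where
  carrier : Set C
  repl : ∀ {A B : C}, A ∈ carrier → (A ≅ B) → B ∈ carrier
  zpart : C → C
  zpart_mem : ∀ A : C, zpart A ∈ carrier
  ε : ∀ A : C, zpart A ⟶ A
  ε_mono : ∀ A : C, Mono (ε A)
  hom_unique : ∀ {Z A : C}, Z ∈ carrier → ∀ f g : Z ⟶ A, f = g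
  lift : ∀ {Z Z' A : C} (z : Z ⟶ A) (z' : Z' ⟶ A), Z ∈ carrier → Z' ∈ carrier → Mono z →
    ∃! φ : Z' ⟶ Z, φ ≫ z = z'

variable {C : Type u} [Category.{v} C]

/-- The ideal `N_𝒵` of morphisms factoring through a zero object. -/
def InIdeal (zc : ZeroClass C) {A B : C} (f : A ⟶ B) : Prop :=
  ∃ (W : C) (g : A ⟶ W) (h : W ⟶ B), W ∈ zc.carrier ∧ g ≫ h = f

/-- `k` is a `𝒵`-kernel of `f`. -/
def IsZKernel (zc : ZeroClass C) {K A B : C} (k : K ⟶ A) (f : A ⟶ B) : Prop :=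
  InIdeal zc (k ≫ f) ∧ ∀ {E : C} (e : E ⟶ A), InIdeal zc (e ≫ f) → ∃! φ : E ⟶ K, φ ≫ k = e

/-- `q` is a `𝒵`-cokernel of `f`. -/
def IsZCokernel (zc : ZeroClass C) {A B Q : C} (q : B ⟶ Q) (f : A ⟶ B) : Prop :=
  InIdeal zc (f ≫ q) ∧ ∀ {P : C} (p : B ⟶ P), InIdeal zc (f ≫ p) → ∃! φ : Q ⟶ P, q ≫ φ = p

/-- `x : X ⟶ M` is a maximum quotient of `X` in `𝒵`. -/
def IsMaxQuotient (zc : ZeroClass C) {X M : C} (x : X ⟶ M) : Prop :=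
  M ∈ zc.carrier ∧ ∀ {Z : C} (z : X ⟶ Z), Z ∈ zc.carrier → ∃ φ : M ⟶ Z, x ≫ φ = z

/-- A morphism is inverted by the zero-part functor `Z` if the induced morphism between
zero parts is an isomorphism. -/
def InvertedByZ (zc : ZeroClass C) {A B : C} (h : A ⟶ B) : Prop :=
  ∃ φ : zc.zpart A ⟶ zc.zpart B, φ ≫ zc.ε B = zc.ε A ≫ h ∧ IsIso φ

/-- A `𝒵`-torsion theory, with chosen short `𝒵`-exact sequences. -/
structure ZTorsionTheory (zc : ZeroClass C) where
  tors : Set C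
  torsFree : Set C
  tors_repl : ∀ {A B : C}, A ∈ tors → (A ≅ B) → B ∈ tors
  torsFree_repl : ∀ {A B : C}, A ∈ torsFree → (A ≅ B) → B ∈ torsFree
  inter : zc.carrier = tors ∩ torsFree
  hom_triv : ∀ {T F : C}, T ∈ tors → F ∈ torsFree → ∀ f : T ⟶ F, InIdeal zc f
  tObj : C → C
  fObj : C → C
  tMem : ∀ A : C, tObj A ∈ tors
  fMem : ∀ A : C, fObj A ∈ torsFree
  t : ∀ A : C, tObj A ⟶ A
  η : ∀ A : C, A ⟶ fObj A
  t_ker : ∀ A : C, IsZKernel zc (t A) (η A)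
  η_coker : ∀ A : C, IsZCokernel zc (η A) (t A)

/-- A class of morphisms of `C`. -/
def MorClass (C : Type u) [Category.{v} C] :=
  ∀ ⦃X Y : C⦄, (X ⟶ Y) → Prop

/-- A class of morphisms is replete (closed under isomorphism in the arrow category). -/
def Replete (E : MorClass C) : Prop :=
  ∀ {A B A' B' : C} (e : A ⟶ B) (e' : A' ⟶ B') (α : A ≅ A') (β : B ≅ B'),
    α.hom ≫ e' = e ≫ β.hom → E e → E e'

/-- The unique diagonal lifting property `e ↓ m`. -/
def UniqueLift {A B X Y : C} (e : A ⟶ B) (m : X ⟶ Y) : Prop :=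
  ∀ (u : A ⟶ X) (v : B ⟶ Y), e ≫ v = u ≫ m → ∃! d : B ⟶ X, e ≫ d = u ∧ d ≫ m = v

/-- A factorization system `(E, M)`. -/
structure IsFactorizationSystem (E M : MorClass C) : Prop where
  E_repl : Replete E
  M_repl : Replete M
  lift : ∀ {A B X Y : C} (e : A ⟶ B) (m : X ⟶ Y), E e → M m → UniqueLift e m
  fac : ∀ {A B : C} (f : A ⟶ B), ∃ (I : C) (e : A ⟶ I) (m : I ⟶ B), E e ∧ M m ∧ e ≫ m = f

/-- `E` is stable under pullback along morphisms of the class `A'`. -/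
def StableAlong (E A' : MorClass C) : Prop :=
  ∀ {P X Y W : C} (p : P ⟶ X) (e' : P ⟶ W) (e : X ⟶ Y) (a : W ⟶ Y),
    IsPullback p e' e a → E e → A' a → E e'

/-- Condition (N). -/
def CondN (zc : ZeroClass C) (tt : ZTorsionTheory zc) : Prop :=
  ∀ {A B K : C} (f : A ⟶ B) (k : K ⟶ A), IsZKernel zc k f →
    ∃ (Q : C) (q : A ⟶ Q), IsZKernel zc (tt.t K ≫ k) q

/-- Condition (M). -/
def CondM (zc : ZeroClass C) (tt : ZTorsionTheory zc) : Prop :=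
  ∀ {T A Q : C} (k : T ⟶ A) (q : A ⟶ Q), T ∈ tt.tors → IsZKernel zc k q →
    IsZCokernel zc q k → Nonempty (tt.fObj T ≅ zc.zpart Q)

/-- Condition (M'). -/
def CondM' (zc : ZeroClass C) (tt : ZTorsionTheory zc) : Prop :=
  ∀ A : C, Nonempty (tt.fObj (tt.tObj A) ≅ zc.zpart (tt.fObj A))

/-- Condition (S). -/
def CondS (zc : ZeroClass C) (tt : ZTorsionTheory zc) : Prop :=
  ∀ {T T' Z' : C} (χ : T' ⟶ Z') (l : T' ⟶ T) (z : Z' ⟶ tt.fObj T),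
    T ∈ tt.tors → Z' ∈ zc.carrier → IsPullback χ l z (tt.η T) →
    T' ∈ tt.tors ∧ IsZCokernel zc χ (𝟙 T')

/-- Condition (P): the reflector is `𝒵`-protoadditive, i.e. it preserves pullbacks of
split epimorphisms along morphisms inverted by `Z`. -/
def CondP (zc : ZeroClass C) (tt : ZTorsionTheory zc) : Prop :=
  ∀ {P A D B : C} (p₁ : P ⟶ A) (p₂ : P ⟶ D) (f : A ⟶ B) (g : D ⟶ B),
    (∃ s : B ⟶ A, s ≫ f = 𝟙 B) → InvertedByZ zc g → IsPullback p₁ p₂ f g →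
    ∀ (Fp₁ : tt.fObj P ⟶ tt.fObj A) (Fp₂ : tt.fObj P ⟶ tt.fObj D)
      (Ff : tt.fObj A ⟶ tt.fObj B) (Fg : tt.fObj D ⟶ tt.fObj B),
      tt.η P ≫ Fp₁ = p₁ ≫ tt.η A → tt.η P ≫ Fp₂ = p₂ ≫ tt.η D →
      tt.η A ≫ Ff = f ≫ tt.η B → tt.η D ≫ Fg = g ≫ tt.η B →
      IsPullback Fp₁ Fp₂ Ff Fg

/-- `h` is a trivial extension: the naturality square of the unit at `h` is a pullback. -/
def IsTrivialExt (zc : ZeroClass C) (tt : ZTorsionTheory zc) {X Y : C} (h : X ⟶ Y) : Prop :=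
  ∃ Fh : tt.fObj X ⟶ tt.fObj Y, tt.η X ≫ Fh = h ≫ tt.η Y ∧
    IsPullback (tt.η X) h Fh (tt.η Y)

/-- A full, replete, reflective subcategory, presented by its reflection data. -/
structure ReflectiveSub (C : Type u) [Category.{v} C] where
  carrier : Set C
  repl : ∀ {A B : C}, A ∈ carrier → (A ≅ B) → B ∈ carrier
  obj : C → C
  mem : ∀ A : C, obj A ∈ carrier
  η : ∀ A : C, A ⟶ obj A
  univ : ∀ {A W : C}, W ∈ carrier → ∀ g : A ⟶ W, ∃! g' : obj A ⟶ W, η A ≫ g' = g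

/-- The data exhibiting a class of zero objects as terminal. -/
structure TerminalData (zc : ZeroClass C) where
  V : C → C
  v : ∀ A : C, A ⟶ V A
  V_mem : ∀ A : C, V A ∈ zc.carrier
  fac : ∀ {A Z : C} (χ : A ⟶ Z), Z ∈ zc.carrier → ∃ φ : Z ⟶ V A, χ ≫ φ = v A

/-- A regular category: finite limits, coequalizers of kernel pairs, and pullback-stable
regular epimorphisms. -/
structure IsRegularCategory (C : Type u) [Category.{v} C] [HasFiniteLimits C] : Prop where
  kernelPair_coeq : ∀ {A B : C} (f : A ⟶ B),
    HasCoequalizer (pullback.fst f f) (pullback.snd f f)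
  regularEpi_stable : ∀ {X Y Z : C} (f : X ⟶ Z) (g : Y ⟶ Z),
    Nonempty (RegularEpi f) → Nonempty (RegularEpi (pullback.snd f g))

/-- A protomodular category. -/
structure IsProtomodular (C : Type u) [Category.{v} C] : Prop where
  hasSplitPullbacks : ∀ {A B X : C} (f : A ⟶ B) (p : X ⟶ B) (s : B ⟶ X),
    s ≫ p = 𝟙 B → HasPullback p f
  split_jointly_extremal : ∀ {A B X Y : C} (f : A ⟶ B) (p : X ⟶ B) (s : B ⟶ X)
      (q : Y ⟶ A) (t : A ⟶ Y) (g : Y ⟶ X),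
      s ≫ p = 𝟙 B → t ≫ q = 𝟙 A → IsPullback g q p f →
      ∀ {M : C} (m : M ⟶ X), Mono m → (∃ g' : Y ⟶ M, g' ≫ m = g) →
        (∃ s' : B ⟶ M, s' ≫ m = s) → IsIso m

/-- An internal equivalence relation given by a jointly monic pair. -/
structure IsEquivRelationPair {R A : C} (r₁ r₂ : R ⟶ A) : Prop where
  jointly_mono : ∀ {W : C} (f g : W ⟶ R), f ≫ r₁ = g ≫ r₁ → f ≫ r₂ = g ≫ r₂ → f = g
  refl : ∃ d : A ⟶ R, d ≫ r₁ = 𝟙 A ∧ d ≫ r₂ = 𝟙 A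
  symm : ∃ s : R ⟶ R, s ≫ r₁ = r₂ ∧ s ≫ r₂ = r₁
  trans : ∀ {W : C} (f g : W ⟶ R), f ≫ r₂ = g ≫ r₁ →
    ∃ h : W ⟶ R, h ≫ r₁ = f ≫ r₁ ∧ h ≫ r₂ = g ≫ r₂

/-- A Barr-exact category: regular and every internal equivalence relation is effective. -/
structure IsBarrExact (C : Type u) [Category.{v} C] [HasFiniteLimits C]
    extends IsRegularCategory C : Prop where
  equivRel_effective : ∀ {R A : C} (r₁ r₂ : R ⟶ A), IsEquivRelationPair r₁ r₂ →
    ∃ (B : C) (q : A ⟶ B), IsPullback r₁ r₂ q q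

namespace IsRegularCategory

lemma regular [HasFiniteLimits C] (h : IsRegularCategory C) : Regular C where
  hasCoequalizer_of_isKernelPair {X Y Z f g₁ g₂} hk := by
    have := h.kernelPair_coeq f
    have e₁ : hk.isoPullback.inv ≫ g₁ = pullback.fst f f := hk.isoPullback_inv_fst
    have e₂ : hk.isoPullback.inv ≫ g₂ = pullback.snd f f := hk.isoPullback_inv_snd
    have hw : g₁ ≫ coequalizer.π (pullback.fst f f) (pullback.snd f f) =
        g₂ ≫ coequalizer.π (pullback.fst f f) (pullback.snd f f) := by
      rw [← cancel_epi hk.isoPullback.inv, reassoc_of% e₁, reassoc_of% e₂,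
        coequalizer.condition]
    refine ⟨⟨⟨Cofork.ofπ _ hw, Cofork.IsColimit.mk' _ fun s => ?_⟩⟩⟩
    have hs : pullback.fst f f ≫ s.π = pullback.snd f f ≫ s.π := by
      rw [← e₁, ← e₂, Category.assoc, Category.assoc, s.condition]
    refine ⟨coequalizer.desc s.π hs, coequalizer.π_desc _ _, fun {m} hm => ?_⟩
    exact coequalizer.hom_ext (hm.trans (coequalizer.π_desc _ _).symm)
  regularEpiIsStableUnderBaseChange := .mk' fun {X Y S} f g _ hg => by
    obtain ⟨hg⟩ := hg
    have hstable := h.regularEpi_stable g f hg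
    have : IsRegularEpi (pullback.snd g f) := ⟨hstable⟩
    rw [← pullbackSymmetry_hom_comp_snd]
    exact (MorphismProperty.cancel_left_of_respectsIso (.regularEpi C) _ _).2 this

end IsRegularCategory

namespace IsProtomodular

/-- In a protomodular category, a morphism of split epimorphisms over `A` whose restriction
along some `v : V ⟶ A` is an isomorphism is itself an isomorphism. -/
lemma isIso_of_isPullback [HasFiniteLimits C] (hproto : IsProtomodular C) {A V X Q K : C}
    {c : X ⟶ Q} {p : X ⟶ A} {q : Q ⟶ A} {s : A ⟶ X} {v : V ⟶ A} {g : K ⟶ X} {r : K ⟶ V}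
    (hc : c ≫ q = p) (hs : s ≫ p = 𝟙 A) (hX : IsPullback g r p v)
    (hQ : IsPullback (g ≫ c) r q v) : IsIso c := by
  have hmono : Mono c := by
    let d : X ⟶ pullback c c := pullback.lift (𝟙 X) (𝟙 X) rfl
    have hd₁ : d ≫ pullback.fst c c = 𝟙 X := pullback.lift_fst _ _ _
    have hd₂ : d ≫ pullback.snd c c = 𝟙 X := pullback.lift_snd _ _ _
    have hp : pullback.fst c c ≫ p = pullback.snd c c ≫ p := by
      rw [← hc, pullback.condition_assoc]
    have hsec : (s ≫ d) ≫ pullback.fst c c ≫ p = 𝟙 A := by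
      rw [Category.assoc, reassoc_of% hd₁, hs]
    have hY := IsPullback.of_hasPullback (pullback.fst c c ≫ p) v
    have hw := hY.w
    let a := hX.lift (pullback.fst (pullback.fst c c ≫ p) v ≫ pullback.fst c c)
      (pullback.snd _ _) (by simpa using hw)
    let b := hX.lift (pullback.fst (pullback.fst c c ≫ p) v ≫ pullback.snd c c)
      (pullback.snd _ _) (by rw [Category.assoc, ← hp]; exact hw)
    have hab : a = b := by
      apply hQ.hom_ext
      · simp only [a, b, hX.lift_fst_assoc, Category.assoc, pullback.condition]
      · simp only [a, b, hX.lift_snd]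
    have hfs : pullback.fst (pullback.fst c c ≫ p) v ≫ pullback.fst c c =
        pullback.fst (pullback.fst c c ≫ p) v ≫ pullback.snd c c := by
      have := congrArg (· ≫ g) hab
      simpa only [a, b, hX.lift_fst] using this
    have hiso : IsIso d := by
      have : Mono d := ⟨fun u w h => by
        have := congrArg (· ≫ pullback.fst c c) h
        simpa only [Category.assoc, hd₁, Category.comp_id] using this⟩
      refine hproto.split_jointly_extremal v (pullback.fst c c ≫ p) (s ≫ d)
        (pullback.snd _ _) (hY.lift (v ≫ s ≫ d) (𝟙 V) ?_) (pullback.fst _ _) hsec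
        (hY.lift_snd _ _ _) hY d this ⟨pullback.fst _ _ ≫ pullback.fst c c, ?_⟩ ⟨s, rfl⟩
      · rw [Category.assoc, hsec, Category.comp_id, Category.id_comp]
      · apply pullback.hom_ext
        · rw [Category.assoc, hd₁, Category.comp_id]
        · rw [Category.assoc, hd₂, Category.comp_id, hfs]
    have heq : pullback.fst c c = pullback.snd c c := by
      rw [← cancel_epi d, hd₁, hd₂]
    exact (IsKernelPair.of_hasPullback c).mono_of_eq_fst_snd heq
  refine hproto.split_jointly_extremal v q (s ≫ c) r (hX.lift (v ≫ s) (𝟙 V) ?_) (g ≫ c) ?_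
    (hX.lift_snd _ _ _) hQ c hmono ⟨g, rfl⟩ ⟨s, rfl⟩
  · rw [Category.assoc, hs, Category.comp_id, Category.id_comp]
  · rw [Category.assoc, hc, hs]

end IsProtomodular

namespace ZeroClass

lemma exists_fac_ε (zc : ZeroClass C) {Z A : C} (hZ : Z ∈ zc.carrier) (z : Z ⟶ A) :
    ∃ φ : Z ⟶ zc.zpart A, φ ≫ zc.ε A = z :=
  (zc.lift (zc.ε A) z (zc.zpart_mem A) hZ (zc.ε_mono A)).exists

lemma inIdeal_iff (zc : ZeroClass C) {A B : C} (f : A ⟶ B) :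
    InIdeal zc f ↔ ∃ g : A ⟶ zc.zpart B, g ≫ zc.ε B = f := by
  constructor
  · rintro ⟨W, g, h, hW, rfl⟩
    obtain ⟨φ, rfl⟩ := zc.exists_fac_ε hW h
    exact ⟨g ≫ φ, Category.assoc _ _ _⟩
  · rintro ⟨g, hg⟩
    exact ⟨_, g, _, zc.zpart_mem B, hg⟩

lemma inIdeal_comp_left (zc : ZeroClass C) {A B D : C} (e : A ⟶ B) {f : B ⟶ D}
    (hf : InIdeal zc f) : InIdeal zc (e ≫ f) := by
  obtain ⟨W, g, h, hW, rfl⟩ := hf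
  exact ⟨W, e ≫ g, h, hW, Category.assoc _ _ _⟩

lemma inIdeal_comp_right (zc : ZeroClass C) {A B D : C} {f : A ⟶ B} (hf : InIdeal zc f)
    (e : B ⟶ D) : InIdeal zc (f ≫ e) := by
  obtain ⟨W, g, h, hW, rfl⟩ := hf
  exact ⟨W, g, h ≫ e, hW, (Category.assoc _ _ _).symm⟩

lemma invertedByZ_of_mem (zc : ZeroClass C) {Z A : C} (hZ : Z ∈ zc.carrier) (z : Z ⟶ A)
    [Mono z] : InvertedByZ zc z := by
  obtain ⟨φ, hφ⟩ := zc.exists_fac_ε (zc.zpart_mem Z) (zc.ε Z ≫ z)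
  obtain ⟨ψ, hψ⟩ := (zc.lift z (zc.ε A) hZ (zc.zpart_mem A) inferInstance).exists
  obtain ⟨θ, -⟩ := zc.exists_fac_ε hZ (𝟙 Z)
  exact ⟨φ, hφ, ψ ≫ θ, zc.hom_unique (zc.zpart_mem _) _ _, zc.hom_unique (zc.zpart_mem _) _ _⟩

lemma isZKernel_pullback [HasFiniteLimits C] (zc : ZeroClass C) {A B : C} (f : A ⟶ B) :
    IsZKernel zc (pullback.fst f (zc.ε B)) f := by
  have := zc.ε_mono B
  refine ⟨(zc.inIdeal_iff _).2 ⟨pullback.snd _ _, pullback.condition.symm⟩, fun e he => ?_⟩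
  obtain ⟨g, hg⟩ := (zc.inIdeal_iff _).1 he
  refine ⟨pullback.lift e g hg.symm, pullback.lift_fst _ _ _, fun y hy => ?_⟩
  rw [← cancel_mono (pullback.fst f (zc.ε B)), hy, pullback.lift_fst]

/-- In a regular category every morphism between zero objects is a regular epimorphism. -/
lemma isRegularEpi_of_mem [Regular C] (zc : ZeroClass C) {Z W : C} (hZ : Z ∈ zc.carrier)
    (hW : W ∈ zc.carrier) (u : Z ⟶ W) : IsRegularEpi u := by
  let S := Regular.strongEpiMonoFactorisation u
  have := zc.ε_mono S.I
  obtain ⟨φ, hφ⟩ := zc.exists_fac_ε hZ S.e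
  have hε : IsIso (zc.ε S.I) := by
    have : StrongEpi (φ ≫ zc.ε S.I) := by rw [hφ]; infer_instance
    have : StrongEpi (zc.ε S.I) := strongEpi_of_strongEpi φ _
    exact isIso_of_mono_of_strongEpi _
  have hI : S.I ∈ zc.carrier := zc.repl (zc.zpart_mem _) (asIso (zc.ε S.I))
  obtain ⟨ψ, hψ⟩ := (zc.lift S.m (𝟙 W) hI hW inferInstance).exists
  have hm : IsIso S.m := ⟨ψ, zc.hom_unique hI _ _, hψ⟩
  have hu : S.e ≫ S.m = u := S.fac
  rw [← hu]
  exact (MorphismProperty.cancel_right_of_respectsIso (.regularEpi C) S.e S.m).2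
    (inferInstanceAs (IsRegularEpi (Regular.strongEpiMonoFactorisation u).e))

end ZeroClass

namespace ZTorsionTheory

variable {zc : ZeroClass C} (tt : ZTorsionTheory zc)

lemma mem_torsFree_of_mem {Z : C} (hZ : Z ∈ zc.carrier) : Z ∈ tt.torsFree := by
  rw [tt.inter] at hZ
  exact hZ.2

lemma existsUnique_desc {X Y : C} (hY : Y ∈ tt.torsFree) (g : X ⟶ Y) :
    ∃! g' : tt.fObj X ⟶ Y, tt.η X ≫ g' = g :=
  (tt.η_coker X).2 g (tt.hom_triv (tt.tMem X) hY _)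

lemma η_hom_ext {X Y : C} {g h : tt.fObj X ⟶ Y} (w : tt.η X ≫ g = tt.η X ≫ h) : g = h :=
  ((tt.η_coker X).2 (tt.η X ≫ h)
    (by
      rw [← Category.assoc]
      exact zc.inIdeal_comp_right (tt.η_coker X).1 h)).unique w rfl

lemma fObj_mem_of_mem_tors {T : C} (hT : T ∈ tt.tors) : tt.fObj T ∈ zc.carrier := by
  obtain ⟨W, g, h, hW, hgh⟩ := tt.hom_triv hT (tt.fMem T) (tt.η T)
  obtain ⟨k, hk, -⟩ := tt.existsUnique_desc (tt.mem_torsFree_of_mem hW) g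
  refine zc.repl hW ⟨h, k, zc.hom_unique hW _ _, tt.η_hom_ext ?_⟩
  rw [reassoc_of% hk, hgh, Category.comp_id]

lemma isIso_η_of_inIdeal {X : C} (h : InIdeal zc (tt.t X)) : IsIso (tt.η X) := by
  obtain ⟨r, hr, -⟩ := (tt.η_coker X).2 (𝟙 X) (by simpa using h)
  exact ⟨r, hr, tt.η_hom_ext (by rw [reassoc_of% hr, Category.comp_id])⟩

lemma mem_torsFree_of_inIdeal {X : C} (h : InIdeal zc (tt.t X)) : X ∈ tt.torsFree := by
  have := tt.isIso_η_of_inIdeal h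
  exact tt.torsFree_repl (tt.fMem X) (asIso (tt.η X)).symm

lemma isIso_η_of_mem {X : C} (hX : X ∈ tt.torsFree) : IsIso (tt.η X) :=
  tt.isIso_η_of_inIdeal (tt.hom_triv (tt.tMem X) hX _)

/-- If the `𝒵`-kernel of `f` is torsion-free, then so is the `𝒵`-kernel of each projection
of the kernel pair of `f`. -/
lemma torsFree_zKernel_of_isKernelPair {A B K X L : C} {f : A ⟶ B} {k : K ⟶ A}
    (hk : IsZKernel zc k f) (hK : K ∈ tt.torsFree) {π₁ π₂ : X ⟶ A}
    (hX : IsKernelPair f π₁ π₂) {l : L ⟶ X} {r : L ⟶ zc.zpart A}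
    (hL : IsPullback l r π₁ (zc.ε A)) : L ∈ tt.torsFree := by
  apply tt.mem_torsFree_of_inIdeal
  have hF := tt.fObj_mem_of_mem_tors (tt.tMem L)
  have hideal : InIdeal zc ((tt.t L ≫ l ≫ π₂) ≫ f) := by
    refine ⟨_, tt.t L ≫ r, zc.ε A ≫ f, zc.zpart_mem A, ?_⟩
    simp only [Category.assoc, ← hX.w, hL.w_assoc]
  obtain ⟨e, he, -⟩ := hk.2 _ hideal
  obtain ⟨a, ha, -⟩ := tt.existsUnique_desc hK e
  obtain ⟨b, hb, -⟩ :=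
    tt.existsUnique_desc (tt.mem_torsFree_of_mem (zc.zpart_mem A)) (tt.t L ≫ r)
  let x := hX.lift (b ≫ zc.ε A) (a ≫ k) (zc.hom_unique hF _ _)
  have hx : x ≫ π₁ = b ≫ zc.ε A := hX.lift_fst _ _ _
  refine ⟨_, tt.η _, hL.lift x b hx, hF, hL.hom_ext (hX.hom_ext ?_ ?_) ?_⟩
  · simp only [Category.assoc, hL.w, hL.lift_snd_assoc, reassoc_of% hb]
  · simp only [Category.assoc, hL.lift_fst_assoc, x, hX.lift_snd, reassoc_of% ha, he]
  · simp only [Category.assoc, hL.lift_snd, hb]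

/-- A split epimorphism with torsion-free `𝒵`-kernel is a trivial extension. -/
lemma isTrivialExt_of_split [HasFiniteLimits C] (hproto : IsProtomodular C)
    (hP : CondP zc tt) {X A : C} {p : X ⟶ A} {s : A ⟶ X} (hs : s ≫ p = 𝟙 A)
    (hL : pullback p (zc.ε A) ∈ tt.torsFree) : IsTrivialExt zc tt p := by
  have := zc.ε_mono A
  have hsq := IsPullback.of_hasPullback p (zc.ε A)
  obtain ⟨Fp, hFp, -⟩ := tt.existsUnique_desc (tt.fMem A) (p ≫ tt.η A)
  obtain ⟨Fε, hFε, -⟩ := tt.existsUnique_desc (tt.fMem A) (zc.ε A ≫ tt.η A)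
  obtain ⟨F₁, hF₁, -⟩ := tt.existsUnique_desc (tt.fMem X) (pullback.fst p (zc.ε A) ≫ tt.η X)
  obtain ⟨F₂, hF₂, -⟩ := tt.existsUnique_desc (tt.fMem (zc.zpart A))
    (pullback.snd p (zc.ε A) ≫ tt.η (zc.zpart A))
  have hF := hP _ _ p (zc.ε A) ⟨s, hs⟩ (zc.invertedByZ_of_mem (zc.zpart_mem A) _) hsq
    F₁ F₂ Fp Fε hF₁ hF₂ hFp hFε
  have := tt.isIso_η_of_mem hL
  have := tt.isIso_η_of_mem (tt.mem_torsFree_of_mem (zc.zpart_mem A))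
  have hbig : IsPullback (pullback.fst p (zc.ε A) ≫ tt.η X) (pullback.snd p (zc.ε A)) Fp
      (zc.ε A ≫ tt.η A) := by
    have hη : IsPullback (tt.η (pullback p (zc.ε A))) (pullback.snd p (zc.ε A)) F₂
        (tt.η (zc.zpart A)) := .of_horiz_isIso ⟨hF₂⟩
    have := hη.flip.paste_vert hF.flip
    rw [hF₁, hFε] at this
    exact this.flip
  have hQ := IsPullback.of_hasPullback Fp (tt.η A)
  let c := hQ.lift (tt.η X) p hFp
  have hc₁ : c ≫ pullback.fst _ _ = tt.η X := hQ.lift_fst _ _ _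
  have hc₂ : c ≫ pullback.snd _ _ = p := hQ.lift_snd _ _ _
  have hrestr : IsPullback (pullback.fst p (zc.ε A) ≫ c) (pullback.snd p (zc.ε A))
      (pullback.snd Fp (tt.η A)) (zc.ε A) := by
    refine .of_right ?_ ?_ hQ
    · rwa [Category.assoc, hc₁]
    · rw [Category.assoc, hc₂, hsq.w]
  have hiso := hproto.isIso_of_isPullback hc₂ hs hsq hrestr
  exact ⟨Fp, hFp, .of_iso_pullback ⟨hFp⟩ (asIso c) hc₁ hc₂⟩

lemma isTrivialExt_of_isKernelPair [HasFiniteLimits C] (hproto : IsProtomodular C)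
    (hP : CondP zc tt) {A B K X : C} {f : A ⟶ B} {k : K ⟶ A} (hk : IsZKernel zc k f)
    (hK : K ∈ tt.torsFree) {π₁ π₂ : X ⟶ A} (hX : IsKernelPair f π₁ π₂) :
    IsTrivialExt zc tt π₁ :=
  tt.isTrivialExt_of_split hproto hP (s := hX.lift (𝟙 A) (𝟙 A) rfl) (hX.lift_fst _ _ _)
    (tt.torsFree_zKernel_of_isKernelPair hk hK hX (.of_hasPullback _ _))

/-- The `𝒵`-kernel of a central extension is torsion-free. -/
lemma torsFree_zKernel_of_central [Regular C] (hS : CondS zc tt) {A B E K : C} {f : A ⟶ B}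
    {g : E ⟶ B} [IsRegularEpi g] (hg : IsTrivialExt zc tt (pullback.snd f g)) {k : K ⟶ A}
    (hk : IsZKernel zc k f) : K ∈ tt.torsFree := by
  obtain ⟨Fh, hFh, hpb⟩ := hg
  apply tt.mem_torsFree_of_inIdeal
  have hT := tt.tMem K
  have hF := tt.fObj_mem_of_mem_tors hT
  obtain ⟨W, a, b, hW, hab⟩ := hk.1
  obtain ⟨a', ha', -⟩ := tt.existsUnique_desc (tt.mem_torsFree_of_mem hW) (tt.t K ≫ a)
  let Y := pullback (a' ≫ b) g
  have hZ := zc.zpart_mem Y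
  let z : zc.zpart Y ⟶ tt.fObj (tt.tObj K) := zc.ε Y ≫ pullback.fst _ _
  let e : zc.zpart Y ⟶ E := zc.ε Y ≫ pullback.snd _ _
  have hze : z ≫ a' ≫ b = e ≫ g := by simp only [z, e, Category.assoc, pullback.condition]
  have : IsRegularEpi z := zc.isRegularEpi_of_mem hZ hF z
  let χ := pullback.fst z (tt.η (tt.tObj K))
  let l := pullback.snd z (tt.η (tt.tObj K))
  obtain ⟨hT', hχ⟩ := hS χ l z hT hZ (.of_hasPullback _ _)
  let x : pullback z (tt.η (tt.tObj K)) ⟶ pullback f g :=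
    pullback.lift (l ≫ tt.t K ≫ k) (χ ≫ e) (by
      simp only [Category.assoc, ← hze, ← hab, ← reassoc_of% ha', l, χ, pullback.condition_assoc])
  obtain ⟨y, hy, -⟩ := hχ.2 (x ≫ tt.η _) (tt.hom_triv hT' (tt.fMem _) _)
  let w := hpb.lift y e (zc.hom_unique hZ _ _)
  have hw : χ ≫ w = x := hpb.hom_ext
    (by simp only [w, Category.assoc, hpb.lift_fst, hy])
    (by simp only [w, Category.assoc, hpb.lift_snd, x, pullback.lift_snd])
  obtain ⟨v, hv⟩ := zc.exists_fac_ε hZ (w ≫ pullback.fst f g)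
  have hsq : CommSq (χ ≫ v) l (zc.ε A) (tt.t K ≫ k) := ⟨by
    rw [Category.assoc, hv, reassoc_of% hw, pullback.lift_fst]⟩
  have := zc.ε_mono A
  have hd := hsq.fac_right
  obtain ⟨j, hj, -⟩ := hk.2 (zc.ε A) ⟨_, 𝟙 _, _, zc.zpart_mem A, Category.id_comp _⟩
  refine ⟨_, hsq.lift, j, zc.zpart_mem A, ?_⟩
  refine (hk.2 (tt.t K ≫ k) ?_).unique ?_ rfl
  · exact Category.assoc (tt.t K) k f ▸ zc.inIdeal_comp_left _ hk.1
  · rw [Category.assoc, hj, hd]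

end ZTorsionTheory

/-- in a Barr-exact protomodular category, for a `𝒵`-torsion theory
satisfying Conditions (S), (M') and (P), and a regular epimorphism `f`, the following
are equivalent: (a) `f` is a normal extension (its kernel pair projections are trivial
extensions); (b) `f` is a central extension (it becomes a trivial extension after
pulling back along some regular epimorphism); (c) the `𝒵`-kernel of `f` is
torsion-free. -/
theorem normal_iff_central_iff_torsionFree_kernel [HasFiniteLimits C]
    (hex : IsBarrExact C) (hproto : IsProtomodular C)
    (zc : ZeroClass C) (tt : ZTorsionTheory zc)
    (hS : CondS zc tt) (hM' : CondM' zc tt) (hP : CondP zc tt)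
    {A B : C} (f : A ⟶ B) (hf : Nonempty (RegularEpi f)) :
    ((IsTrivialExt zc tt (pullback.fst f f) ∧ IsTrivialExt zc tt (pullback.snd f f)) ↔
      (∃ (E : C) (g : E ⟶ B), Nonempty (RegularEpi g) ∧
        IsTrivialExt zc tt (pullback.snd f g))) ∧
    ((∃ (E : C) (g : E ⟶ B), Nonempty (RegularEpi g) ∧
        IsTrivialExt zc tt (pullback.snd f g)) ↔
      (∃ (K : C) (k : K ⟶ A), IsZKernel zc k f ∧ K ∈ tt.torsFree)) := by
  have := hex.toIsRegularCategory.regular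
  have hac : (∃ (K : C) (k : K ⟶ A), IsZKernel zc k f ∧ K ∈ tt.torsFree) →
      IsTrivialExt zc tt (pullback.fst f f) ∧ IsTrivialExt zc tt (pullback.snd f f) := by
    rintro ⟨K, k, hk, hK⟩
    have hX := IsKernelPair.of_hasPullback f
    exact ⟨tt.isTrivialExt_of_isKernelPair hproto hP hk hK hX,
      tt.isTrivialExt_of_isKernelPair hproto hP hk hK hX.flip⟩
  have hbc : (∃ (E : C) (g : E ⟶ B), Nonempty (RegularEpi g) ∧
        IsTrivialExt zc tt (pullback.snd f g)) →
      ∃ (K : C) (k : K ⟶ A), IsZKernel zc k f ∧ K ∈ tt.torsFree := by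
    rintro ⟨E, g, hg, ht⟩
    have : IsRegularEpi g := ⟨hg⟩
    exact ⟨_, _, zc.isZKernel_pullback f,
      tt.torsFree_zKernel_of_central hS ht (zc.isZKernel_pullback f)⟩
  exact ⟨⟨fun h => ⟨A, f, hf, h.2⟩, fun h => hac (hbc h)⟩,
    ⟨hbc, fun h => ⟨A, f, hf, (hac h).2⟩⟩⟩
end

section
/- Let m be a positive integer and A an additive abelian group. Then every additive group homomorphism from A to ℤ/mℤ is zero if and only if A is h-divisible for every positive divisor h of m, i.e., for every positive h dividing m and every a ∈ A there exists b ∈ A with h • b = a. -/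
/-- The cyclic group of order `n` embeds in the cyclic group of order `m` when `n ∣ m`. -/
theorem ZMod.exists_injective_addMonoidHom_of_dvd {n m : ℕ} (hm : 0 < m) (h : n ∣ m) :
    ∃ g : ZMod n →+ ZMod m, Function.Injective g := by
  obtain ⟨k, rfl⟩ := h
  have hk : (k : ℤ) ≠ 0 := by
    rintro h0
    simp_all
  refine ⟨ZMod.lift n ⟨(zmultiplesHom (ZMod (n * k))) (k : ZMod (n * k)), ?_⟩, ?_⟩
  · have : ((n * k : ℕ) : ZMod (n * k)) = 0 := ZMod.natCast_self _
    simpa only [zmultiplesHom_apply, natCast_zsmul, nsmul_eq_mul, Nat.cast_mul] using this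
  · rw [ZMod.lift_injective]
    intro z hz
    have hz' : ((z * k : ℤ) : ZMod (n * k)) = 0 := by simpa using hz
    rw [ZMod.intCast_zmod_eq_zero_iff_dvd] at hz' ⊢
    push_cast at hz'
    exact Int.dvd_of_mul_dvd_mul_right hk hz'

/-- Homomorphisms to `ℤ/pℤ`, with `p` prime, separate the elements of a group of exponent `p`. -/
theorem eq_zero_of_forall_hom_zmod_apply_eq_zero {A : Type*} [AddCommGroup A] {p : ℕ}
    (hp : p.Prime) (hA : ∀ x : A, p • x = 0) {a : A} (ha : ∀ f : A →+ ZMod p, f a = 0) :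
    a = 0 := by
  have : Fact p.Prime := ⟨hp⟩
  have separates [Module (ZMod p) A] : a = 0 :=
    (Module.forall_dual_apply_eq_zero_iff (ZMod p) a).1 fun φ ↦ ha φ.toAddMonoidHom
  exact @separates (AddCommGroup.zmodModule hA)

/-- An element killed by every homomorphism to `ℤ/pℤ`, with `p` prime, is a multiple of `p`. -/
theorem exists_nsmul_eq_of_forall_hom_zmod_apply_eq_zero {A : Type*} [AddCommGroup A] {p : ℕ}
    (hp : p.Prime) {a : A} (ha : ∀ f : A →+ ZMod p, f a = 0) : ∃ b : A, p • b = a := by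
  let q := QuotientAddGroup.mk' (nsmulAddMonoidHom (α := A) p).range
  have hq : q a = 0 := by
    refine eq_zero_of_forall_hom_zmod_apply_eq_zero hp (fun x ↦ ?_) fun f ↦ ha (f.comp q)
    obtain ⟨y, rfl⟩ := QuotientAddGroup.mk_surjective x
    rw [← QuotientAddGroup.mk_nsmul, QuotientAddGroup.eq_zero_iff]
    exact ⟨y, rfl⟩
  exact (QuotientAddGroup.eq_zero_iff a).1 hq

/-- every additive group homomorphism `A →+ ℤ/mℤ` is zero iff `A` is
`h`-divisible for every positive divisor `h` of `m`. -/
theorem hom_zmod_eq_zero_iff_divisible (m : ℕ) (hm : 0 < m) (A : Type*)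
    [AddCommGroup A] :
    (∀ f : A →+ ZMod m, f = 0) ↔
      ∀ h : ℕ, 0 < h → h ∣ m → ∀ a : A, ∃ b : A, h • b = a := by
  constructor
  · intro hf h
    induction h using Nat.recOnMul with
    | zero => intro h0; exact absurd h0 (lt_irrefl 0)
    | one => exact fun _ _ a ↦ ⟨a, one_nsmul a⟩
    | prime p hp =>
      intro _ hpm a
      obtain ⟨g, hg⟩ := ZMod.exists_injective_addMonoidHom_of_dvd hm hpm
      refine exists_nsmul_eq_of_forall_hom_zmod_apply_eq_zero hp fun f ↦ hg ?_
      simpa using DFunLike.congr_fun (hf (g.comp f)) a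
    | mul k l hk hl =>
      intro hkl hd a
      obtain ⟨b, rfl⟩ := hk (Nat.pos_of_mul_pos_right hkl) (dvd_of_mul_right_dvd hd) a
      obtain ⟨c, rfl⟩ := hl (Nat.pos_of_mul_pos_left hkl) (dvd_of_mul_left_dvd hd) b
      exact ⟨c, mul_nsmul' c k l⟩
  · intro hdiv f
    ext a
    obtain ⟨b, rfl⟩ := hdiv m hm dvd_rfl a
    simp
end

section
/- Let m be a positive integer and A an additive abelian group. Define D_m(A) = { a ∈ A | there exists a sequence (a_n)_{n ∈ ℕ} in A with a_0 = a and a_n = m • a_{n+1} for all n }; this set is an additive subgroup of A. Then the quotient group A / D_m(A) has trivial D_m: for every a ∈ A, if the class of a in A / D_m(A) admits a sequence (x_n)_{n ∈ ℕ} of classes with x_0 = [a] and x_n = m • x_{n+1} for all n, then a ∈ D_m(A). -/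
/-- The subgroup `D_m(A)` of elements that are coherently infinitely `m`-divisible:
elements `a` admitting a sequence `(a_n)` with `a_0 = a` and `a_n = m • a_{n+1}`. -/
def Dm (m : ℕ) (A : Type*) [AddCommGroup A] : AddSubgroup A where
  carrier := {a : A | ∃ s : ℕ → A, s 0 = a ∧ ∀ n : ℕ, s n = m • s (n + 1)}
  zero_mem' := ⟨fun _ => 0, rfl, fun _ => (smul_zero m).symm⟩
  add_mem' := by
    rintro a b ⟨s, hs0, hs⟩ ⟨t, ht0, ht⟩
    refine ⟨fun n => s n + t n, ?_, fun n => ?_⟩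
    · simp [hs0, ht0]
    · show s n + t n = m • (s (n + 1) + t (n + 1))
      rw [smul_add, ← hs n, ← ht n]
  neg_mem' := by
    rintro a ⟨s, hs0, hs⟩
    refine ⟨fun n => -s n, by simp [hs0], fun n => ?_⟩
    show -s n = m • (-s (n + 1))
    rw [smul_neg, ← hs n]

/-- `D_m(A)` is `m`-divisible. -/
theorem exists_mem_Dm_eq_smul {m : ℕ} {A : Type*} [AddCommGroup A] {d : A} (hd : d ∈ Dm m A) :
    ∃ e ∈ Dm m A, d = m • e := by
  obtain ⟨s, rfl, hs⟩ := hd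
  exact ⟨s 1, ⟨fun n => s (n + 1), rfl, fun n => hs (n + 1)⟩, hs 0⟩

/-- the quotient `A ⧸ D_m(A)` has trivial `D_m`: if the class of `a`
admits a sequence of classes `(x_n)` with `x_0 = [a]` and `x_n = m • x_{n+1}`,
then `a ∈ D_m(A)`. -/
theorem quotient_Dm_trivial (m : ℕ) (hm : 0 < m) (A : Type*) [AddCommGroup A] (a : A)
    (h : ∃ x : ℕ → A ⧸ Dm m A, x 0 = (QuotientAddGroup.mk a : A ⧸ Dm m A) ∧
      ∀ n : ℕ, x n = m • x (n + 1)) :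
    a ∈ Dm m A := by
  obtain ⟨x, hx0, hx⟩ := h
  choose b hb using fun n => QuotientAddGroup.mk_surjective (x n)
  have hd (n : ℕ) : b n - m • b (n + 1) ∈ Dm m A := by
    rw [← QuotientAddGroup.eq_zero_iff, QuotientAddGroup.mk_sub, QuotientAddGroup.mk_nsmul,
      hb, hb, ← hx, sub_self]
  have h0 : a - b 0 ∈ Dm m A := by
    rw [← QuotientAddGroup.eq_zero_iff, QuotientAddGroup.mk_sub, hb, hx0, sub_self]
  choose f hf hfm using fun d : Dm m A => exists_mem_Dm_eq_smul d.2
  let e : ℕ → Dm m A := fun n =>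
    Nat.rec ⟨a - b 0, h0⟩ (fun k d => ⟨f (⟨_, hd k⟩ + d), hf _⟩) n
  refine ⟨fun n => b n + (e n).1, ?_, fun n => ?_⟩
  · exact add_sub_cancel (b 0) a
  have he : b n - m • b (n + 1) + (e n).1 = m • (e (n + 1)).1 := hfm (⟨_, hd n⟩ + e n)
  show b n + (e n).1 = m • (b (n + 1) + (e (n + 1)).1)
  rw [smul_add, ← he]
  abel
end
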